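/- arXiv:1902.09443 — 2 statements merged into one kernel-verified Lean document; each statement's English description precedes it below -/
import Mathlib

section
/- For every integer m ≥ 1 and real p with 1 ≤ p ≤ 2·log((2m+1)/(2m))/log((m+1)/m), every real (d+m)×(d+m) symmetric positive semidefinite matrix A of rank d (with 1 ≤ m < d) whose diagonal entries all equal 1 satisfies ∑_{i≠j} |A_{i,j}|^p ≥ 2m. -/
open Finset

/-- The sum of the reciprocals `(∑ⱼ Aᵢⱼ²)⁻¹` over the rows of a real symmetric matrix with unit
diagonal is at most its rank. -/
theorem sum_inv_sum_sq_le_rank {n : Type*} [Fintype n] [DecidableEq n] {A : Matrix n n ℝ}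
    (hA : A.IsHermitian) (hdiag : ∀ i, A i i = 1) :
    ∑ i, (∑ j, A i j ^ 2)⁻¹ ≤ A.rank := by
  set U : Matrix n n ℝ := hA.eigenvectorUnitary.1
  set l := hA.eigenvalues
  have hUU : U.transpose * U = 1 := by
    have := Unitary.coe_star_mul_self hA.eigenvectorUnitary
    rwa [Matrix.star_eq_conjTranspose, Matrix.conjTranspose_eq_transpose_of_trivial] at this
  have hspec : A = U * Matrix.diagonal l * U.transpose := by
    have := hA.spectral_theorem
    rw [Unitary.conjStarAlgAut_apply] at this
    simpa [U, l, Function.comp_def, Matrix.star_eq_conjTranspose,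
      Matrix.conjTranspose_eq_transpose_of_trivial] using this
  have hdiag' : ∀ i, ∑ k, l k * U i k ^ 2 = 1 := by
    intro i
    rw [← hdiag i, hspec]
    rw [Matrix.mul_apply]
    simp only [Matrix.mul_diagonal, Matrix.transpose_apply]
    exact sum_congr rfl fun k _ => by ring
  have hsq : ∀ i, ∑ j, A i j ^ 2 = ∑ k, l k ^ 2 * U i k ^ 2 := by
    intro i
    have h1 : ∑ j, A i j ^ 2 = (A * A) i i := by
      rw [Matrix.mul_apply]
      refine sum_congr rfl fun j _ => ?_
      rw [sq, show A j i = A i j by simpa using hA.apply i j]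
    have h2 : A * A = U * Matrix.diagonal (fun k => l k * l k) * U.transpose := by
      calc A * A = U * Matrix.diagonal l * U.transpose * (U * Matrix.diagonal l * U.transpose) := by
            rw [← hspec]
        _ = U * Matrix.diagonal l * (U.transpose * U) * Matrix.diagonal l * U.transpose := by
            simp only [Matrix.mul_assoc]
        _ = _ := by
            rw [hUU, Matrix.mul_one, Matrix.mul_assoc U, Matrix.diagonal_mul_diagonal]
    rw [h1, h2]
    rw [Matrix.mul_apply]
    simp only [Matrix.mul_diagonal, Matrix.transpose_apply]
    exact sum_congr rfl fun k _ => by ring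
  have hcol : ∀ k, ∑ i, U i k ^ 2 = 1 := by
    intro k
    have := congrFun (congrFun hUU k) k
    simpa [Matrix.mul_apply, sq] using this
  have hrow : ∀ i, (∑ j, A i j ^ 2)⁻¹ ≤ ∑ k with l k ≠ 0, U i k ^ 2 := by
    intro i
    have hpos : 0 < ∑ j, A i j ^ 2 :=
      sum_pos' (fun j _ => sq_nonneg _) ⟨i, mem_univ i, by simp [hdiag i]⟩
    have hcs := sum_mul_sq_le_sq_mul_sq ({k | l k ≠ 0} : Finset n) (fun k => l k * U i k)
      (fun k => U i k)
    have e1 : ∑ k with l k ≠ 0, l k * U i k * U i k = 1 := by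
      rw [← hdiag' i, sum_filter]
      refine sum_congr rfl fun k _ => ?_
      by_cases h : l k = 0 <;> simp [h, sq, mul_assoc]
    have e2 : ∑ k with l k ≠ 0, (l k * U i k) ^ 2 ≤ ∑ j, A i j ^ 2 := by
      rw [hsq i]
      simp only [mul_pow]
      exact sum_le_sum_of_subset_of_nonneg (filter_subset _ _) fun k _ _ => by positivity
    rw [e1] at hcs
    rw [inv_le_iff_one_le_mul₀ hpos]
    have e3 : 0 ≤ ∑ k with l k ≠ 0, U i k ^ 2 := sum_nonneg fun k _ => sq_nonneg _
    nlinarith [mul_le_mul_of_nonneg_right e2 e3]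
  calc ∑ i, (∑ j, A i j ^ 2)⁻¹ ≤ ∑ i, ∑ k with l k ≠ 0, U i k ^ 2 := sum_le_sum fun i _ => hrow i
    _ = ∑ k with l k ≠ 0, ∑ i, U i k ^ 2 := sum_comm
    _ = A.rank := by
      rw [hA.rank_eq_card_non_zero_eigs, Fintype.card_subtype]
      simp [hcol, l]

/-- The function `x ↦ (x / (1 - x)) ^ r`, written in terms of `y = x / (1 - x)`, lies above its
tangent line at the point `x₀ = y₀ / (1 + y₀)`. -/
theorem tangent_le_rpow {r y y₀ : ℝ} (hr : 1 / 2 ≤ r) (hy : 0 ≤ y) (hy₀ : 0 < y₀)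
    (h : (1 - y₀) / (2 * y₀) ≤ √(y / y₀)) :
    y₀ ^ r * (1 - r * (1 + y₀)) + y₀ ^ r * (r * (1 + y₀) ^ 2 / y₀) * (y / (1 + y)) ≤ y ^ r := by
  set s := √(y / y₀) with hs
  have hs0 : 0 ≤ s := Real.sqrt_nonneg _
  have hs2 : s ^ 2 = y / y₀ := Real.sq_sqrt (by positivity)
  have hys : y = y₀ * s ^ 2 := by rw [hs2]; field_simp
  have hyr : y ^ r = y₀ ^ r * s ^ (2 * r) := by
    rw [hys, Real.mul_rpow hy₀.le (by positivity), Real.rpow_mul hs0, Real.rpow_two]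
  have hbern : 1 + 2 * r * (s - 1) ≤ s ^ (2 * r) := by
    have := one_add_mul_self_le_rpow_one_add (s := s - 1) (p := 2 * r) (by linarith) (by linarith)
    simpa using this
  have hK : (1 + y₀) * (s ^ 2 - 1) / (1 + y₀ * s ^ 2) ≤ 2 * (s - 1) := by
    rw [div_le_iff₀ (by positivity)]
    rw [div_le_iff₀ (by positivity)] at h
    nlinarith [mul_nonneg (sq_nonneg (s - 1)) (sub_nonneg.2 h)]
  have hr0 : 0 ≤ r := by linarith
  calc _ = y₀ ^ r * (1 + r * ((1 + y₀) * (s ^ 2 - 1) / (1 + y₀ * s ^ 2))) := by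
        rw [hys]
        have : 1 + y₀ * s ^ 2 ≠ 0 := by positivity
        field_simp
        ring
    _ ≤ y₀ ^ r * s ^ (2 * r) := by
        gcongr
        nlinarith [mul_le_mul_of_nonneg_left hK hr0]
    _ = y ^ r := hyr.symm

theorem le_of_two_rpow_le {r : ℝ} (h : (2 : ℝ) ^ r ≤ 3 / 2) : r ≤ 16 / 27 := by
  by_contra! hr
  have h1 : (2 : ℝ) ^ (16 / 27 : ℝ) < 3 / 2 :=
    (Real.rpow_lt_rpow_of_exponent_lt (by norm_num) hr).trans_le h
  have h2 : ((2 : ℝ) ^ (16 / 27 : ℝ)) ^ 27 < (3 / 2) ^ 27 :=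
    pow_lt_pow_left₀ h1 (by positivity) (by norm_num)
  rw [← Real.rpow_natCast, ← Real.rpow_mul (by norm_num)] at h2
  norm_num at h2

theorem four_mul_le_rpow {r y : ℝ} (hr : 1 / 2 ≤ r) (h2 : (2 : ℝ) ^ r ≤ 3 / 2)
    (hy : 0 ≤ y) (hy8 : y < 1 / 8) : 4 * r * (y / (1 + y)) ≤ y ^ r := by
  rcases hy.eq_or_lt with rfl | hy0
  · simp only [zero_div, mul_zero]
    positivity
  have hr27 := le_of_two_rpow_le h2
  have h8 : (8 : ℝ) ^ r ≤ 27 / 8 := by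
    calc (8 : ℝ) ^ r = ((2 : ℝ) ^ r) ^ 3 := by
          rw [← Real.rpow_mul_natCast (by norm_num), mul_comm, Real.rpow_mul (by norm_num)]
          norm_num
      _ ≤ (3 / 2) ^ 3 := pow_le_pow_left₀ (by positivity) h2 3
      _ = 27 / 8 := by norm_num
  have hle : (8 * y) ≤ (8 * y) ^ r := by
    simpa using Real.rpow_le_rpow_of_exponent_ge (x := 8 * y) (by positivity) (by linarith)
      (show r ≤ 1 by linarith)
  rw [Real.mul_rpow (by norm_num) hy] at hle
  have hyr : 0 ≤ y ^ r := by positivity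
  have hx : y / (1 + y) ≤ y := div_le_self hy (by linarith)
  nlinarith [mul_le_mul_of_nonneg_right h8 hyr, mul_le_mul_of_nonneg_left hx
    (show 0 ≤ 4 * r by linarith), mul_le_mul_of_nonneg_right hr27 hy]

theorem rpow_two_le_of_one_add_inv_rpow_le {r : ℝ} {m : ℕ} (hm : 1 ≤ m) (hr0 : 0 ≤ r) (hr1 : r ≤ 1)
    (h : (((m : ℝ) + 1) / m) ^ r ≤ (2 * m + 1) / (2 * m)) : (2 : ℝ) ^ r ≤ 3 / 2 := by
  have hm' : (1 : ℝ) ≤ m := by exact_mod_cast hm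
  set u : ℝ := 1 / m with hu
  have hu0 : 0 < u := by positivity
  have hu1 : u ≤ 1 := by rw [hu, div_le_one (by positivity)]; exact hm'
  have hconc := (Real.concaveOn_rpow hr0 hr1).2 (x := 1) (y := 2) (by simp) (by simp)
    (sub_nonneg.2 hu1) hu0.le (by ring)
  simp only [smul_eq_mul, Real.one_rpow, mul_one] at hconc
  have e1 : 1 - u + u * 2 = ((m : ℝ) + 1) / m := by rw [hu]; field_simp; ring
  have e2 : (2 * (m : ℝ) + 1) / (2 * m) = 1 + u / 2 := by rw [hu]; field_simp
  rw [e1] at hconc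
  rw [e2] at h
  have : u * ((2 : ℝ) ^ r) ≤ u * (3 / 2) := by linarith
  exact le_of_mul_le_mul_left this hu0

/-- The scalar form of the energy bound: `yᵢ` plays the role of the sum of the squares of the
off-diagonal entries in the `i`-th row, and `r` that of `p / 2`. -/
theorem two_mul_le_sum_rpow {ι : Type*} [Fintype ι] {r : ℝ} {m : ℕ} (hm : 1 ≤ m)
    (hr : 1 / 2 ≤ r) (h : (((m : ℝ) + 1) / m) ^ r ≤ (2 * m + 1) / (2 * m))
    {y : ι → ℝ} (hy : ∀ i, 0 ≤ y i) (hsum : (m : ℝ) ≤ ∑ i, y i / (1 + y i)) :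
    (2 * m : ℝ) ≤ ∑ i, y i ^ r := by
  have hm' : (1 : ℝ) ≤ m := by exact_mod_cast hm
  set y₀ : ℝ := m / (m + 1) with hy₀
  have hy₀pos : 0 < y₀ := by positivity
  have hy₀half : 1 / 2 ≤ y₀ := by rw [hy₀, div_le_div_iff₀] <;> linarith
  have hy₀one : y₀ ≤ 1 := by rw [hy₀, div_le_one] <;> linarith
  have hy₀r : 2 * (m : ℝ) / (2 * m + 1) ≤ y₀ ^ r := by
    have := inv_anti₀ (by positivity) h
    rwa [← Real.inv_rpow (by positivity), inv_div, inv_div] at this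
  have hr1 : r ≤ 1 := by
    by_contra! hlt
    have h1 : ((m : ℝ) + 1) / m ≤ (((m : ℝ) + 1) / m) ^ r := by
      apply Real.self_le_rpow_of_one_le _ hlt.le
      rw [le_div_iff₀ (by linarith)]
      linarith
    have h2 := h1.trans h
    rw [div_le_div_iff₀ (by positivity) (by positivity)] at h2
    nlinarith
  have hrm : r * (1 + y₀) ≤ 1 := by
    have h1 := rpow_one_add_le_one_add_mul_self (s := y₀ - 1) (p := r) (by linarith) (by linarith)
      hr1
    rw [add_sub_cancel] at h1
    have h2 := hy₀r.trans h1
    have e1 : 1 + r * (y₀ - 1) = 1 - r / (m + 1) := by rw [hy₀]; field_simp; ring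
    have e2 : 1 + y₀ = (2 * m + 1) / (m + 1) := by rw [hy₀]; field_simp; ring
    have e3 : 2 * (m : ℝ) / (2 * m + 1) = 1 - 1 / (2 * m + 1) := by field_simp; ring
    rw [e1, e3] at h2
    have h3 : r / ((m : ℝ) + 1) ≤ 1 / (2 * m + 1) := by linarith
    rw [div_le_div_iff₀ (by positivity) (by positivity)] at h3
    rw [e2, ← mul_div_assoc, div_le_one (by positivity)]
    linarith
  have h2 := rpow_two_le_of_one_add_inv_rpow_le hm (by linarith) hr1 h
  have hx : ∀ i, 0 ≤ y i / (1 + y i) := fun i => div_nonneg (hy i) (by linarith [hy i])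
  set C : Finset ι := {i | 1 / 8 ≤ y i}
  rcases le_or_gt (#C) (2 * m) with hC | hC
  · have hC' : (#C : ℝ) ≤ 2 * m := by exact_mod_cast hC
    have hterm : ∀ i, 4 * r * (y i / (1 + y i)) + (if 1 / 8 ≤ y i then 1 - 2 * r else 0)
        ≤ y i ^ r := by
      intro i
      split_ifs with hi
      · have := tangent_le_rpow hr (hy i) one_pos (by simp)
        norm_num at this
        linarith
      · simpa using four_mul_le_rpow hr h2 (hy i) (not_le.1 hi)
    have htot := sum_le_sum fun i (_ : i ∈ univ) => hterm i
    rw [sum_add_distrib, ← mul_sum, ← sum_filter, sum_const, nsmul_eq_mul] at htot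
    change _ + (#C : ℝ) * _ ≤ _ at htot
    nlinarith [mul_le_mul_of_nonneg_left hsum (show 0 ≤ 4 * r by linarith),
      mul_nonneg (sub_nonneg.2 hC') (show 0 ≤ 2 * r - 1 by linarith)]
  · have hC' : 2 * (m : ℝ) + 1 ≤ #C := by exact_mod_cast hC
    set E := y₀ ^ r * (1 - r * (1 + y₀)) with hE
    set G := y₀ ^ r * (r * (1 + y₀) ^ 2 / y₀) with hG
    have hE0 : 0 ≤ E := mul_nonneg (by positivity) (by linarith)
    have hG0 : 0 ≤ G := mul_nonneg (by positivity)
      (div_nonneg (mul_nonneg (by linarith) (by positivity)) hy₀pos.le)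
    have hG4 : G ≤ 4 * r := by
      have hw : y₀ ^ r ≤ √y₀ := by
        rw [Real.sqrt_eq_rpow]
        exact Real.rpow_le_rpow_of_exponent_ge hy₀pos hy₀one hr
      set w := √y₀
      have hw2 : w ^ 2 = y₀ := Real.sq_sqrt hy₀pos.le
      have hw0 : 0 ≤ w := Real.sqrt_nonneg _
      have hw1 : w ≤ 1 := Real.sqrt_le_one.2 hy₀one
      have hwh : 1 / 2 ≤ w := by nlinarith
      have hpoly : (1 + w ^ 2) ^ 2 ≤ 4 * w := by
        nlinarith [mul_nonneg (sub_nonneg.2 hw1)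
          (show 0 ≤ w ^ 3 + w ^ 2 + 3 * w - 1 by nlinarith [pow_nonneg hw0 3])]
      have hk : y₀ ^ r * (1 + y₀) ^ 2 ≤ 4 * y₀ := by
        calc y₀ ^ r * (1 + y₀) ^ 2 ≤ w * (1 + y₀) ^ 2 := by gcongr
          _ ≤ w * (4 * w) := by rw [← hw2]; gcongr
          _ = 4 * y₀ := by rw [← hw2]; ring
      rw [hG, ← mul_div_assoc, div_le_iff₀ hy₀pos]
      nlinarith [mul_le_mul_of_nonneg_left hk (show 0 ≤ r by linarith)]
    have hterm : ∀ i, G * (y i / (1 + y i)) + (if 1 / 8 ≤ y i then E else 0) ≤ y i ^ r := by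
      intro i
      split_ifs with hi
      · rw [add_comm]
        refine tangent_le_rpow hr (hy i) hy₀pos (Real.le_sqrt_of_sq_le ?_)
        have e : (1 - y₀) / (2 * y₀) = 1 / (2 * m) := by rw [hy₀]; field_simp; ring
        have e' : y i / y₀ = y i * (m + 1) / m := by rw [hy₀]; field_simp
        rw [e, e', div_pow, div_le_div_iff₀ (by positivity) (by positivity)]
        have : (1 / 8 : ℝ) * (m + 1) * (2 * m) ^ 2 ≤ y i * (m + 1) * (2 * m) ^ 2 := by gcongr
        nlinarith
      · have := four_mul_le_rpow hr h2 (hy i) (not_le.1 hi)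
        nlinarith [mul_le_mul_of_nonneg_right hG4 (hx i)]
    have htot := sum_le_sum fun i (_ : i ∈ univ) => hterm i
    rw [sum_add_distrib, ← mul_sum, ← sum_filter, sum_const, nsmul_eq_mul] at htot
    change _ + (#C : ℝ) * _ ≤ _ at htot
    have hEG : (2 * m + 1) * E + G * m = (2 * m + 1) * y₀ ^ r := by
      have e : (1 + y₀) ^ 2 / y₀ * m = (2 * m + 1) * (1 + y₀) := by
        rw [hy₀]; field_simp; ring
      calc (2 * m + 1) * E + G * m = y₀ ^ r * ((2 * m + 1) * (1 - r * (1 + y₀))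
            + r * ((1 + y₀) ^ 2 / y₀ * m)) := by rw [hE, hG]; ring
        _ = _ := by rw [e]; ring
    rw [div_le_iff₀ (by positivity)] at hy₀r
    nlinarith [mul_le_mul_of_nonneg_left hsum hG0, mul_le_mul_of_nonneg_right hC' hE0]

theorem rpow_sum_le_sum_rpow {ι : Type*} (s : Finset ι) {f : ι → ℝ} (hf : ∀ i, 0 ≤ f i)
    {r : ℝ} (hr0 : 0 < r) (hr1 : r ≤ 1) : (∑ i ∈ s, f i) ^ r ≤ ∑ i ∈ s, f i ^ r :=
  le_sum_of_subadditive_on_pred (fun x : ℝ => x ^ r) (fun x => 0 ≤ x) (Real.zero_rpow hr0.ne').le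
    (fun _ _ hx hy => Real.rpow_add_le_add_rpow hx hy hr0.le hr1) (fun _ _ => add_nonneg) f
    fun i _ => hf i

/-- Main theorem: for `p ∈ [1, 2·log((2m+1)/(2m))/log((m+1)/m)]` and a real
`(d+m)×(d+m)` positive semidefinite matrix of rank `d` with unit diagonal,
the `p`-frame energy `∑_{i≠j} |A i j|^p` is at least `2m`. -/
theorem frame_energy_lower_bound (d m : ℕ) (hm : 1 ≤ m) (hmd : m < d)
    (p : ℝ) (hp1 : 1 ≤ p)
    (hp2 : p ≤ 2 * Real.log ((2 * m + 1) / (2 * m)) / Real.log ((m + 1) / m))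
    (A : Matrix (Fin (d + m)) (Fin (d + m)) ℝ)
    (hA : A.PosSemidef) (hrank : A.rank = d) (hdiag : ∀ i, A i i = 1) :
    (2 * m : ℝ) ≤ ∑ i, ∑ j, if i ≠ j then |A i j| ^ p else 0 := by
  have hm' : (1 : ℝ) ≤ m := by exact_mod_cast hm
  have hbase : 1 < ((m : ℝ) + 1) / m := by
    rw [lt_div_iff₀ (by linarith)]
    linarith
  have hpow : (((m : ℝ) + 1) / m) ^ (p / 2) ≤ (2 * m + 1) / (2 * m) := by
    rw [le_div_iff₀ (Real.log_pos hbase)] at hp2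
    rw [Real.rpow_le_iff_le_log (by positivity) (by positivity)]
    linarith
  have hr1 : p / 2 ≤ 1 := by
    by_contra! hlt
    have h1 := (Real.self_le_rpow_of_one_le hbase.le hlt.le).trans hpow
    rw [div_le_div_iff₀ (by positivity) (by positivity)] at h1
    nlinarith
  have hy : ∀ i, 0 ≤ ∑ j with i ≠ j, A i j ^ 2 := fun i => sum_nonneg fun j _ => sq_nonneg _
  have hsplit : ∀ i, ∑ j, A i j ^ 2 = 1 + ∑ j with i ≠ j, A i j ^ 2 := by
    intro i
    rw [← sum_filter_add_sum_filter_not univ (fun j => i = j)]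
    simp [filter_eq, hdiag i]
  have hsum : (m : ℝ) ≤ ∑ i, (∑ j with i ≠ j, A i j ^ 2) / (1 + ∑ j with i ≠ j, A i j ^ 2) := by
    have h1 := sum_inv_sum_sq_le_rank hA.isHermitian hdiag
    rw [hrank] at h1
    have h2 : ∀ i, (∑ j with i ≠ j, A i j ^ 2) / (1 + ∑ j with i ≠ j, A i j ^ 2)
        = 1 - (∑ j, A i j ^ 2)⁻¹ := by
      intro i
      have := hy i
      rw [hsplit i]
      field_simp
      ring
    simp only [h2, sum_sub_distrib, sum_const, card_univ, Fintype.card_fin, nsmul_eq_mul,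
      mul_one, Nat.cast_add]
    linarith
  refine (two_mul_le_sum_rpow hm (by linarith) hpow hy hsum).trans (sum_le_sum fun i _ => ?_)
  rw [← sum_filter]
  refine (rpow_sum_le_sum_rpow _ (fun j => sq_nonneg (A i j)) (by linarith) hr1).trans_eq
    (sum_congr rfl fun j _ => ?_)
  rw [← sq_abs, ← Real.rpow_two, ← Real.rpow_mul (abs_nonneg _)]
  congr 1
  ring
end

section
/- For integers m ≥ 1 and j with m ≤ j ≤ 4m, let q = log((2m+1)/(2m))/log((m+1)/m) and define g_j(x) = j·(mx/(1−mx))^q + (m(1−jx)/(1−m(1−jx)))^q for x ∈ (1/(j+1), 1/j). Then g_j(x) ≥ 2m for all x in this interval. -/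
open Real Set

/-- The difference of the logarithms of two positive affine functions is concave as soon as the
logarithmic derivative of the first dominates that of the second in absolute value. -/
theorem concaveOn_log_affine_sub_log_affine {α β γ δ : ℝ} {D : Set ℝ} (hD : Convex ℝ D)
    (h₁ : ∀ x ∈ D, 0 < α + β * x) (h₂ : ∀ x ∈ D, 0 < γ + δ * x)
    (h : ∀ x ∈ D, (δ / (γ + δ * x)) ^ 2 ≤ (β / (α + β * x)) ^ 2) :
    ConcaveOn ℝ D (fun x => log (α + β * x) - log (γ + δ * x)) := by
  have affine (a b x : ℝ) : HasDerivAt (fun x => a + b * x) b x := by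
    simpa using ((hasDerivAt_id x).const_mul b).const_add a
  have logAffine (a b x : ℝ) (hx : 0 < a + b * x) :
      HasDerivAt (fun x => log (a + b * x)) (b / (a + b * x)) x :=
    (affine a b x).log hx.ne'
  have divAffine (a b x : ℝ) (hx : 0 < a + b * x) :
      HasDerivAt (fun x => b / (a + b * x)) (-(b / (a + b * x)) ^ 2) x := by
    refine ((hasDerivAt_const x b).div (affine a b x) hx.ne').congr_deriv ?_
    rw [div_pow]
    ring
  refine concaveOn_of_hasDerivWithinAt2_nonpos hD
    (f' := fun x => β / (α + β * x) - δ / (γ + δ * x))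
    (f'' := fun x => -(β / (α + β * x)) ^ 2 - -(δ / (γ + δ * x)) ^ 2) ?_ ?_ ?_ ?_
  · intro x hx
    exact ((logAffine α β x (h₁ x hx)).sub
      (logAffine γ δ x (h₂ x hx))).continuousAt.continuousWithinAt
  · intro x hx
    have hx := interior_subset hx
    exact ((logAffine α β x (h₁ x hx)).sub (logAffine γ δ x (h₂ x hx))).hasDerivWithinAt
  · intro x hx
    have hx := interior_subset hx
    exact ((divAffine α β x (h₁ x hx)).sub (divAffine γ δ x (h₂ x hx))).hasDerivWithinAt
  · intro x hx
    linarith [h x (interior_subset hx)]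

/-- Jensen's inequality for `x ↦ x ^ c` at the points `1` and `a`. -/
theorem half_one_add_rpow_le {a c : ℝ} (ha : 0 < a) (hc : c ≤ 0 ∨ 1 ≤ c) :
    ((1 + a) / 2) ^ c ≤ (1 + a ^ c) / 2 := by
  rcases hc with hc | hc
  · have hsq : a ^ (1 / 2 : ℝ) ≤ (1 + a) / 2 := by
      have h : (a ^ (1 / 2 : ℝ)) ^ 2 = a := by
        rw [← rpow_natCast, ← rpow_mul ha.le]
        norm_num
      nlinarith [sq_nonneg (a ^ (1 / 2 : ℝ) - 1)]
    have h₁ := rpow_le_rpow_of_nonpos (rpow_pos_of_pos ha _) hsq hc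
    have h₂ : (a ^ (1 / 2 : ℝ)) ^ c = a ^ (c / 2) := by
      rw [← rpow_mul ha.le]
      ring_nf
    have h₃ : (a ^ (c / 2)) ^ 2 = a ^ c := by
      rw [← rpow_natCast, ← rpow_mul ha.le]
      norm_num
    nlinarith [sq_nonneg (a ^ (c / 2) - 1)]
  · have h := (convexOn_rpow hc).2 (mem_Ici.2 zero_le_one) (mem_Ici.2 ha.le)
      (by norm_num : (0 : ℝ) ≤ 1 / 2) (by norm_num : (0 : ℝ) ≤ 1 / 2) (by norm_num)
    simp only [smul_eq_mul, one_rpow] at h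
    calc ((1 + a) / 2) ^ c = (1 / 2 * 1 + 1 / 2 * a) ^ c := by ring_nf
      _ ≤ 1 / 2 * 1 + 1 / 2 * a ^ c := h
      _ = (1 + a ^ c) / 2 := by ring

/-- The energy `k * (m / (k - m)) ^ q` of `k` equal points is at least `2 * m` for `k` outside
`(2 * m, 2 * m + 1)`. -/
theorem two_mul_le_mul_div_rpow {m k q : ℝ} (hm : 0 < m) (hmk : m < k)
    (hk : k ≤ 2 * m ∨ 2 * m + 1 ≤ k)
    (hq : q = log ((2 * m + 1) / (2 * m)) / log ((m + 1) / m)) :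
    2 * m ≤ k * (m / (k - m)) ^ q := by
  set a : ℝ := (m + 1) / m with ha
  set w : ℝ := (k - m) / m with hw
  have ha1 : 1 < a := by rw [ha, one_lt_div hm]; linarith
  have ha0 : 0 < a := by linarith
  have hloga : 0 < log a := log_pos ha1
  have hw0 : 0 < w := div_pos (by linarith) hm
  have haq : a ^ q = (1 + a) / 2 := by
    have h : (1 + a) / 2 = (2 * m + 1) / (2 * m) := by rw [ha]; field_simp; ring
    rw [h, rpow_def_of_pos ha0, hq, mul_div_cancel₀ _ hloga.ne', exp_log (by positivity)]
  have hac : a ^ (log w / log a) = w := by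
    rw [rpow_def_of_pos ha0, mul_div_cancel₀ _ hloga.ne', exp_log hw0]
  have hc : log w / log a ≤ 0 ∨ 1 ≤ log w / log a := by
    rcases hk with hk | hk
    · left
      refine div_nonpos_of_nonpos_of_nonneg (log_nonpos hw0.le ?_) hloga.le
      rw [hw, div_le_one hm]
      linarith
    · right
      rw [one_le_div hloga]
      refine log_le_log ha0 ?_
      rw [hw, ha]
      gcongr
      linarith
  have hwq : w ^ q ≤ (1 + w) / 2 := by
    have h := half_one_add_rpow_le ha0 hc
    rwa [hac, ← haq, ← rpow_mul ha0.le, mul_comm, rpow_mul ha0.le, hac] at h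
  have hinv : m / (k - m) = w⁻¹ := by rw [hw, inv_div]
  rw [hinv, inv_rpow hw0.le, ← div_eq_mul_inv, le_div_iff₀ (rpow_pos_of_pos hw0 q)]
  have h : 2 * m * ((1 + w) / 2) = k := by rw [hw]; field_simp; ring
  calc 2 * m * w ^ q ≤ 2 * m * ((1 + w) / 2) := by gcongr
    _ = k := h

theorem hasDerivAt_div_one_sub_rpow {q s : ℝ} (hs : 0 < s) (hs1 : s < 1) :
    HasDerivAt (fun s => (s / (1 - s)) ^ q)
      (q * exp ((q - 1) * log s - (q + 1) * log (1 - s))) s := by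
  have h1 : 0 < 1 - s := by linarith
  have h : HasDerivAt (fun s : ℝ => s / (1 - s)) (1 / (1 - s) ^ 2) s := by
    refine ((hasDerivAt_id s).div ((hasDerivAt_id s).const_sub 1) h1.ne').congr_deriv ?_
    simp
  convert h.rpow_const (p := q) (Or.inl (div_pos hs h1).ne') using 1
  have h2 : 1 / (1 - s) ^ 2 = exp (-2 * log (1 - s)) := by
    rw [← exp_log h1, log_exp, ← exp_nat_mul, one_div, ← exp_neg]
    norm_num
  have h3 : (s / (1 - s)) ^ (q - 1) = exp ((q - 1) * (log s - log (1 - s))) := by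
    rw [rpow_def_of_pos (div_pos hs h1), log_div hs.ne' h1.ne', mul_comm]
  have h4 : (q - 1) * log s - (q + 1) * log (1 - s) =
      (q - 1) * (log s - log (1 - s)) + -2 * log (1 - s) := by ring
  rw [h2, h3, h4, exp_add]
  ring

/-- On `[m / (j + 1), m / j]`, the energy of `j` points `s` and one point `m - j * s` is bounded
below by its values at the two ends. -/
theorem le_energy_of_le_energy_endpoints {m j q C s : ℝ} (hm : 0 < m) (hmj : m + 1 ≤ j)
    (hq0 : 0 < q) (hq1 : q < 1)
    (hleft : C ≤ (j + 1) * (m / (j + 1 - m)) ^ q) (hright : C ≤ j * (m / (j - m)) ^ q)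
    (hs : s ∈ Ioo (m / (j + 1)) (m / j)) :
    C ≤ j * (s / (1 - s)) ^ q + ((m - j * s) / (1 - (m - j * s))) ^ q := by
  have hj : 0 < j := by linarith
  set a := m / (j + 1) with ha
  set b := m / j with hb
  set g : ℝ → ℝ := fun s => j * (s / (1 - s)) ^ q + ((m - j * s) / (1 - (m - j * s))) ^ q with hg
  have ha0 : 0 < a := by positivity
  have hja : m - j * a = a := by rw [ha]; field_simp; ring
  have hjb : j * b = m := by rw [hb]; field_simp
  have hb1 : b < 1 := by rw [hb, div_lt_one hj]; linarith
  have hab : a < b := hs.1.trans hs.2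
  have hmem : ∀ y ∈ Ico a b, 0 < y ∧ y < 1 ∧ 0 < m - j * y ∧ m - j * y ≤ y ∧ m - j * y < 1 := by
    intro y ⟨hy1, hy2⟩
    have e1 : j * a ≤ j * y := by gcongr
    have e2 : j * y < j * b := by gcongr
    refine ⟨by linarith, by linarith, by linarith, by linarith, by linarith⟩
  set L : ℝ → ℝ := fun y => (1 - q) * (log (m + -j * y) - log (0 + 1 * y)) +
    (1 + q) * (log (1 - m + j * y) - log (1 + -1 * y)) with hL
  have hconc : ConcaveOn ℝ (Ico a b) L := by
    refine ConcaveOn.add (ConcaveOn.smul (by linarith : 0 ≤ 1 - q) ?_)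
      (ConcaveOn.smul (by linarith : 0 ≤ 1 + q) ?_)
    · refine concaveOn_log_affine_sub_log_affine (convex_Ico a b) ?_ ?_ ?_
      · intro y hy
        linarith [hmem y hy]
      · intro y hy
        linarith [hmem y hy]
      · intro y hy
        obtain ⟨h0, h1, h2, h3, h4⟩ := hmem y hy
        rw [sq_le_sq, abs_div, abs_div, abs_neg, abs_one, abs_of_pos hj,
          abs_of_pos (by linarith), abs_of_pos (by linarith)]
        exact div_le_div₀ hj.le (by linarith) (by linarith) (by linarith)
    · refine concaveOn_log_affine_sub_log_affine (convex_Ico a b) ?_ ?_ ?_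
      · intro y hy
        linarith [hmem y hy]
      · intro y hy
        linarith [hmem y hy]
      · intro y hy
        obtain ⟨h0, h1, h2, h3, h4⟩ := hmem y hy
        rw [sq_le_sq, abs_div, abs_div, abs_neg, abs_one, abs_of_pos hj,
          abs_of_pos (by linarith), abs_of_pos (by linarith),
          div_le_div_iff₀ (by linarith) (by linarith)]
        have e2 : j * y < j * b := by have := hy.2; gcongr
        linarith
  have hLa : L a = 0 := by
    have e1 : m + -j * a = a := by linarith
    have e2 : 1 - m + j * a = 1 - a := by linarith
    have e3 : 1 + -1 * a = 1 - a := by ring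
    simp only [hL, e1, e2, e3, zero_add, one_mul, sub_self, mul_zero]
  set A : ℝ → ℝ := fun y => (q - 1) * log y - (q + 1) * log (1 - y) with hA
  have hLA : ∀ y, L y = A y - A (m - j * y) := by
    intro y
    have e1 : m + -j * y = m - j * y := by ring
    have e2 : 1 - m + j * y = 1 - (m - j * y) := by ring
    have e3 : 1 + -1 * y = 1 - y := by ring
    simp only [hL, hA, e1, e2, e3, zero_add, one_mul]
    ring
  have hderiv : ∀ y ∈ Ico a b,
      HasDerivAt g (j * q * (exp (A y) - exp (A (m - j * y)))) y := by
    intro y hy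
    obtain ⟨h0, h1, h2, h3, h4⟩ := hmem y hy
    have ht : HasDerivAt (fun y => m - j * y) (-j) y := by
      simpa using ((hasDerivAt_id y).const_mul j).const_sub m
    have hc := (hasDerivAt_div_one_sub_rpow (q := q) h2 h4).comp y ht
    refine (((hasDerivAt_div_one_sub_rpow (q := q) h0 h1).const_mul j).add hc).congr_deriv ?_
    ring
  have hga : C ≤ g a := by
    have e : a / (1 - a) = m / (j + 1 - m) := by
      rw [ha, one_sub_div (by positivity), div_div_div_cancel_right₀ (by positivity)]
    have : g a = (j + 1) * (m / (j + 1 - m)) ^ q := by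
      simp only [hg, hja, e]
      ring
    rwa [this]
  have hgb : C ≤ g b := by
    have e : b / (1 - b) = m / (j - m) := by
      rw [hb, one_sub_div hj.ne', div_div_div_cancel_right₀ hj.ne']
    have : g b = j * (m / (j - m)) ^ q := by
      simp only [hg, hjb, e]
      simp [hq0.ne']
    rwa [this]
  have hamem : a ∈ Ico a b := ⟨le_rfl, hab⟩
  have hsmem : s ∈ Ico a b := ⟨hs.1.le, hs.2⟩
  rcases le_or_gt 0 (L s) with hLs | hLs
  · have hsub : Icc a s ⊆ Ico a b := Icc_subset_Ico_right hs.2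
    have hmono : MonotoneOn g (Icc a s) := by
      refine monotoneOn_of_hasDerivWithinAt_nonneg (convex_Icc a s)
        (fun y hy => (hderiv y (hsub hy)).continuousAt.continuousWithinAt)
        (fun y hy => (hderiv y (hsub (interior_subset hy))).hasDerivWithinAt) fun y hy => ?_
      have hy := interior_subset hy
      have h := hconc.min_le_of_mem_Icc hamem hsmem hy
      rw [hLa, min_eq_left hLs, hLA, sub_nonneg, ← exp_le_exp, ← sub_nonneg] at h
      positivity
    exact hga.trans (hmono (left_mem_Icc.2 hs.1.le) (right_mem_Icc.2 hs.1.le) hs.1.le)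
  · have hanti : AntitoneOn g (Icc s b) := by
      have hsub : Ioo s b ⊆ Ico a b := fun y hy => ⟨(hs.1.trans hy.1).le, hy.2⟩
      refine antitoneOn_of_hasDerivWithinAt_nonpos (convex_Icc s b) (fun y hy => ?_)
        (f' := fun y => j * q * (exp (A y) - exp (A (m - j * y)))) (fun y hy => ?_) fun y hy => ?_
      · have e1 : j * y ≤ j * b := by have := hy.2; gcongr
        have e2 : j * a ≤ j * y := by have := hs.1.le.trans hy.1; gcongr
        have d1 : 1 - y ≠ 0 := by linarith [hy.2]
        have d2 : 1 - (m - j * y) ≠ 0 := by linarith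
        refine ContinuousAt.continuousWithinAt ?_
        refine ContinuousAt.add (continuousAt_const.mul ?_) ?_
        · exact (ContinuousAt.div (by fun_prop) (by fun_prop) d1).rpow_const (Or.inr hq0.le)
        · exact (ContinuousAt.div (f := fun y => m - j * y) (g := fun y => 1 - (m - j * y))
            (a := y) (by fun_prop) (by fun_prop) d2).rpow_const (Or.inr hq0.le)
      · rw [interior_Icc] at hy ⊢
        exact (hderiv y (hsub hy)).hasDerivWithinAt
      · rw [interior_Icc] at hy
        have h : L y ≤ 0 := by
          by_contra! hcon
          have h := hconc.min_le_of_mem_Icc hamem (hsub hy) ⟨hs.1.le, hy.1.le⟩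
          rw [hLa, min_eq_left hcon.le] at h
          linarith
        rw [hLA, sub_nonpos, ← exp_le_exp, ← sub_nonpos] at h
        exact mul_nonpos_of_nonneg_of_nonpos (by positivity) h
    exact hgb.trans (hanti (left_mem_Icc.2 hs.2.le) (right_mem_Icc.2 hs.2.le) hs.2.le)

/-- The estimate when the number of equal points is `m` itself, where the right endpoint is
singular. -/
theorem two_mul_le_energy_self {m : ℕ} {q s : ℝ} (hm : 1 ≤ m) (hq : 1 / 2 ≤ q)
    (hs : (m : ℝ) / (m + 1) < s) (hs1 : s < 1) :
    (2 * m : ℝ) ≤ m * (s / (1 - s)) ^ q + ((m - m * s) / (1 - (m - m * s))) ^ q := by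
  have hm1 : (1 : ℝ) ≤ m := by exact_mod_cast hm
  have hq0 : 0 < q := by linarith
  have hs0 : 0 < s := lt_trans (by positivity) hs
  have h1s : 0 < 1 - s := by linarith
  have hden : 0 < 1 - (m - m * s) := by
    rw [div_lt_iff₀ (by positivity)] at hs
    nlinarith
  set u := s / (1 - s) with hu
  set v := (m - m * s) / (1 - (m - m * s)) with hv
  have hu0 : 0 < u := by positivity
  have hv0 : 0 < v := div_pos (by nlinarith) hden
  have huv : (m : ℝ) ^ (m + 1) ≤ u ^ m * v := by
    have hbern := one_add_mul_le_pow (a := u / m - 1) (by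
      have : 0 < u / m := by positivity
      linarith) m
    have e : 1 + m * (u / m - 1) = m / v := by
      have : (m : ℝ) - m * s ≠ 0 := by nlinarith
      rw [hu, hv]
      field_simp
      ring
    rw [e, add_sub_cancel, div_pow, div_le_div_iff₀ hv0 (by positivity)] at hbern
    calc (m : ℝ) ^ (m + 1) = m * m ^ m := by ring
      _ ≤ u ^ m * v := hbern
  have hM : (0 : ℝ) < m + 1 := by positivity
  have amgm := geom_mean_le_arith_mean2_weighted (w₁ := m / (m + 1)) (w₂ := 1 / (m + 1))
    (p₁ := u ^ q) (p₂ := v ^ q) (by positivity) (by positivity) (by positivity) (by positivity)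
    (by field_simp)
  have hprod : (m : ℝ) ^ q ≤ (u ^ q) ^ ((m : ℝ) / (m + 1)) * (v ^ q) ^ (1 / ((m : ℝ) + 1)) := by
    have e1 : (u ^ q) ^ ((m : ℝ) / (m + 1)) * (v ^ q) ^ (1 / ((m : ℝ) + 1))
        = (u ^ m * v) ^ (q / (m + 1)) := by
      rw [mul_rpow (by positivity) hv0.le, ← rpow_natCast u m, ← rpow_mul hu0.le,
        ← rpow_mul hu0.le, ← rpow_mul hv0.le]
      ring_nf
    have e2 : (m : ℝ) ^ q = ((m : ℝ) ^ (m + 1)) ^ (q / (m + 1)) := by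
      rw [← rpow_natCast, ← rpow_mul (by positivity)]
      congr 1
      push_cast
      field_simp
    rw [e1, e2]
    exact rpow_le_rpow (by positivity) huv (by positivity)
  have hsqrt : √m ≤ (m : ℝ) ^ q := by
    rw [sqrt_eq_rpow]
    exact rpow_le_rpow_of_exponent_le hm1 hq
  have hsq : √(m : ℝ) ^ 2 = m := sq_sqrt (by positivity)
  have hsqrt1 : 1 ≤ √(m : ℝ) := one_le_sqrt.2 hm1
  have hle : √(m : ℝ) ≤ m / (m + 1) * u ^ q + 1 / (m + 1) * v ^ q := by linarith
  have e : (m : ℝ) * u ^ q + v ^ q = (m + 1) * (m / (m + 1) * u ^ q + 1 / (m + 1) * v ^ q) := by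
    field_simp
  rw [e]
  calc (2 * m : ℝ) ≤ (m + 1) * √m := by nlinarith [sq_nonneg (√(m : ℝ) - 1)]
    _ ≤ _ := by gcongr

/-- Key interval estimate: for `m ≤ j ≤ 4m`, `q = log((2m+1)/(2m))/log((m+1)/m)`,
and `x ∈ (1/(j+1), 1/j)`, the function
`g_j(x) = j·(mx/(1−mx))^q + (m(1−jx)/(1−m(1−jx)))^q` satisfies `g_j(x) ≥ 2m`. -/
theorem g_j_interval_bound (m j : ℕ) (hm : 1 ≤ m) (hj1 : m ≤ j) (hj2 : j ≤ 4 * m)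
    (q : ℝ) (hq : q = Real.log ((2 * m + 1) / (2 * m)) / Real.log ((m + 1) / m))
    (x : ℝ) (hx : x ∈ Set.Ioo (1 / ((j : ℝ) + 1)) (1 / (j : ℝ))) :
    (2 * m : ℝ) ≤ (j : ℝ) * ((m * x) / (1 - m * x)) ^ q +
      ((m * (1 - j * x)) / (1 - m * (1 - j * x))) ^ q := by
  have hm0 : (0 : ℝ) < m := by exact_mod_cast hm
  have hlog : 0 < log (((m : ℝ) + 1) / m) := log_pos (by rw [one_lt_div hm0]; linarith)
  have hq_half : 1 / 2 ≤ q := by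
    have h : log (((m : ℝ) + 1) / m) ≤ 2 * log ((2 * m + 1) / (2 * m)) := by
      rw [← log_rpow (by positivity)]
      refine log_le_log (by positivity) ?_
      rw [rpow_two, div_pow, div_le_div_iff₀ hm0 (by positivity)]
      nlinarith
    rw [hq, le_div_iff₀ hlog]
    linarith
  have hq1 : q < 1 := by
    rw [hq, div_lt_one hlog]
    refine log_lt_log (by positivity) ?_
    rw [div_lt_div_iff₀ (by positivity) hm0]
    nlinarith
  have hsub : (m : ℝ) * (1 - j * x) = m - j * (m * x) := by ring
  have hs1 : (m : ℝ) / (j + 1) < m * x := by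
    rw [div_eq_mul_one_div]
    exact mul_lt_mul_of_pos_left hx.1 hm0
  have hs2 : (m : ℝ) * x < m / j := by
    rw [div_eq_mul_one_div (m : ℝ) (j : ℝ)]
    exact mul_lt_mul_of_pos_left hx.2 hm0
  rw [hsub]
  rcases hj1.eq_or_lt with rfl | hlt
  · rw [div_self hm0.ne'] at hs2
    exact two_mul_le_energy_self hm hq_half hs1 hs2
  · have hmj : (m : ℝ) + 1 ≤ j := by exact_mod_cast hlt
    refine le_energy_of_le_energy_endpoints hm0 hmj (by linarith) hq1 ?_ ?_ ⟨hs1, hs2⟩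
    · refine two_mul_le_mul_div_rpow hm0 (by linarith) ?_ hq
      rcases lt_or_ge j (2 * m) with h | h
      · left; exact_mod_cast h
      · right; exact_mod_cast Nat.succ_le_succ h
    · refine two_mul_le_mul_div_rpow hm0 (by linarith) ?_ hq
      rcases le_or_gt j (2 * m) with h | h
      · left; exact_mod_cast h
      · right; exact_mod_cast h
end
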